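/- Let p, q ≥ 1 and let λ = (λ_0 ≥ λ_1 ≥ ... ≥ λ_{p-1} ≥ 0) be the partition associated to a finite order ideal T ⊆ ℕ² (where λ_j = 1 + max{i : (i,j) ∈ T}, or 0 if no such i). Then T is contained in the region {(x,y) ∈ ℕ² : p·x + q·y < (p-1)(q-1)} if and only if a·q - p·λ_{p-1-a} ≥ 0 for all 0 ≤ a < p. -/

import Mathlib

/-- `T` is an order ideal of ℕ² : downward closed in the componentwise order. -/
def IsOrderIdeal (T : Finset (ℕ × ℕ)) : Prop :=
  ∀ a ∈ T, ∀ b : ℕ × ℕ, b.1 ≤ a.1 → b.2 ≤ a.2 → b ∈ T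

/-- λ_j = 1 + max{i : (i,j) ∈ T}, or 0 if no such i. -/
def lamb (T : Finset (ℕ × ℕ)) (j : ℕ) : ℕ :=
  (T.filter fun z => z.2 = j).sup fun z => z.1 + 1

theorem lamb_le_iff (T : Finset (ℕ × ℕ)) (j n : ℕ) :
    lamb T j ≤ n ↔ ∀ x, (x, j) ∈ T → x + 1 ≤ n := by
  simp only [lamb, Finset.sup_le_iff, Finset.mem_filter]
  constructor
  · intro h x hx
    exact h (x, j) ⟨hx, rfl⟩
  · rintro h ⟨x, y⟩ ⟨hz, rfl⟩
    exact h x hz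

theorem mul_lamb_le_iff (T : Finset (ℕ × ℕ)) {p : ℕ} (hp : 0 < p) (j n : ℕ) :
    p * lamb T j ≤ n ↔ ∀ x, (x, j) ∈ T → p * (x + 1) ≤ n := by
  simp only [mul_comm p, ← Nat.le_div_iff_mul_le hp, lamb_le_iff]

theorem lt_pred_mul_pred_iff {p q : ℕ} (hp : 1 ≤ p) (hq : 1 ≤ q) (x y : ℕ) :
    p * x + q * y < (p - 1) * (q - 1) ↔ p * (x + 1) + q * (y + 1) ≤ p * q := by
  obtain ⟨m, rfl⟩ := Nat.exists_eq_add_of_le' hp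
  obtain ⟨n, rfl⟩ := Nat.exists_eq_add_of_le' hq
  simp only [Nat.add_sub_cancel]
  constructor <;> intro h <;> nlinarith

/-- T is contained in the region {(x,y) : p x + q y < (p-1)(q-1)} iff
    a·q - p·λ_{p-1-a} ≥ 0 for all 0 ≤ a < p. -/
theorem stmt1 (p q : ℕ) (hp : 1 ≤ p) (hq : 1 ≤ q)
    (T : Finset (ℕ × ℕ)) (hT : IsOrderIdeal T) :
    (∀ z ∈ T, p * z.1 + q * z.2 < (p - 1) * (q - 1)) ↔
      (∀ a < p, p * lamb T (p - 1 - a) ≤ a * q) := by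
  constructor
  · intro h a ha
    rw [mul_lamb_le_iff T hp]
    intro x hx
    have hlt := (lt_pred_mul_pred_iff hp hq _ _).1 (h _ hx)
    have hsplit : p * q = q * (p - 1 - a + 1) + a * q := by
      have hpa : p = (p - 1 - a + 1) + a := by omega
      calc p * q = ((p - 1 - a + 1) + a) * q := by rw [← hpa]
        _ = _ := by ring
    dsimp only at hlt
    omega
  · rintro h ⟨x, y⟩ hz
    rw [lt_pred_mul_pred_iff hp hq]
    have hy : y < p - 1 := by
      by_contra! hy
      have h0 := (mul_lamb_le_iff T hp _ _).1 (h 0 hp) x (hT _ hz _ le_rfl hy)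
      nlinarith
    have hrow : p - 1 - (p - 1 - y) = y := by omega
    have hle := h (p - 1 - y) (by omega)
    rw [hrow, mul_lamb_le_iff T hp] at hle
    have hsplit : p * q = q * (y + 1) + (p - 1 - y) * q := by
      have hpy : p = (y + 1) + (p - 1 - y) := by omega
      calc p * q = ((y + 1) + (p - 1 - y)) * q := by rw [← hpy]
        _ = _ := by ring
    have := hle x hz
    dsimp only
    omega
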